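/- arXiv:math/0205276 — 4 statements merged into one kernel-verified Lean document; each statement's English description precedes it below -/
import Mathlib

section
/- Let A be a normed ring (so the norm is submultiplicative: ‖xy‖ ≤ ‖x‖·‖y‖). Let S ⊆ A be a totally bounded subset and suppose there is a real number r < 1 such that ‖x‖ ≤ r for all x ∈ S. Then the multiplicative closure ⋃_{n ≥ 1} Sⁿ, where Sⁿ denotes the set of all products x₁·x₂·⋯·xₙ with each xᵢ ∈ S, is totally bounded. -/
open Pointwise

theorem TotallyBounded.mul_of_seminormedRing {A : Type*} [NonUnitalSeminormedRing A] {s t : Set A}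
    (hs : TotallyBounded s) (ht : TotallyBounded t) : TotallyBounded (s * t) := by
  obtain ⟨M, hM, hsM⟩ := hs.isBounded.exists_pos_norm_le
  obtain ⟨K, hK, htK⟩ := ht.isBounded.exists_pos_norm_le
  refine Metric.totallyBounded_iff.2 fun ε hε ↦ ?_
  have hδ : 0 < ε / (K + M) := by positivity
  obtain ⟨u, hus, hu, hsu⟩ := Metric.finite_approx_of_totallyBounded hs _ hδ
  obtain ⟨v, -, hv, htv⟩ := Metric.finite_approx_of_totallyBounded ht _ hδ
  refine ⟨u * v, hu.mul hv, ?_⟩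
  rintro _ ⟨x, hx, y, hy, rfl⟩
  obtain ⟨a, ha, hxa⟩ := Set.mem_iUnion₂.1 (hsu hx)
  obtain ⟨b, hb, hyb⟩ := Set.mem_iUnion₂.1 (htv hy)
  refine Set.mem_iUnion₂.2 ⟨a * b, Set.mul_mem_mul ha hb, ?_⟩
  rw [mem_ball_iff_norm] at hxa hyb ⊢
  calc ‖x * y - a * b‖ = ‖(x - a) * y + a * (y - b)‖ := by
        rw [sub_mul, mul_sub, sub_add_sub_cancel]
    _ ≤ ‖x - a‖ * ‖y‖ + ‖a‖ * ‖y - b‖ :=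
        (norm_add_le _ _).trans (add_le_add (norm_mul_le _ _) (norm_mul_le _ _))
    _ ≤ ‖x - a‖ * K + M * ‖y - b‖ := by
        gcongr
        · exact htK y hy
        · exact hsM a (hus ha)
    _ < ε / (K + M) * K + M * (ε / (K + M)) := by gcongr
    _ = ε := by field_simp

theorem TotallyBounded.pow_of_seminormedRing {A : Type*} [SeminormedRing A] {s : Set A}
    (hs : TotallyBounded s) (n : ℕ) : TotallyBounded (s ^ n) := by
  induction n with
  | zero => simpa using (Set.finite_one (α := A)).totallyBounded
  | succ n ih => rw [pow_succ]; exact ih.mul_of_seminormedRing hs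

theorem norm_le_pow_of_mem_pow_succ {A : Type*} [SeminormedRing A] {s : Set A} {r : ℝ}
    (hs : ∀ x ∈ s, ‖x‖ ≤ r) (n : ℕ) : ∀ x ∈ s ^ (n + 1), ‖x‖ ≤ r ^ (n + 1) := by
  induction n with
  | zero => simpa using hs
  | succ n ih =>
    rw [pow_succ s, pow_succ r]
    rintro _ ⟨x, hx, y, hy, rfl⟩
    exact norm_mul_le_of_le (ih x hx) (hs y hy)

/-- In a normed ring, the multiplicative closure ⋃_{n ≥ 1} Sⁿ of a
totally bounded set S with ‖x‖ ≤ r < 1 for all x ∈ S is totally bounded. -/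
theorem totallyBounded_multiplicative_closure
    {A : Type*} [NormedRing A] (S : Set A) (hS : TotallyBounded S)
    (r : ℝ) (hr : r < 1) (hSr : ∀ x ∈ S, ‖x‖ ≤ r) :
    TotallyBounded (⋃ n : ℕ, S ^ (n + 1)) := by
  obtain rfl | ⟨x, hx⟩ := S.eq_empty_or_nonempty
  · simp
  have hr0 : 0 ≤ r := (norm_nonneg x).trans (hSr x hx)
  refine Metric.totallyBounded_iff.2 fun ε hε ↦ ?_
  obtain ⟨N, hN⟩ := exists_pow_lt_of_lt_one hε hr
  have hfin : TotallyBounded (⋃ n ∈ Set.Iio N, S ^ (n + 1)) :=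
    (totallyBounded_biUnion (Set.finite_Iio N)).2 fun n _ ↦ hS.pow_of_seminormedRing (n + 1)
  obtain ⟨t, ht, hcover⟩ := Metric.totallyBounded_iff.1 hfin ε hε
  refine ⟨insert 0 t, ht.insert 0, Set.iUnion_subset fun n y hy ↦ ?_⟩
  rw [Set.biUnion_insert]
  obtain hn | hn := lt_or_ge n N
  · exact Or.inr (hcover (Set.mem_biUnion hn hy))
  · refine Or.inl (mem_ball_zero_iff.2 ?_)
    calc ‖y‖ ≤ r ^ (n + 1) := norm_le_pow_of_mem_pow_succ hSr n y hy
      _ ≤ r ^ N := pow_le_pow_of_le_one hr0 hr.le (by lia)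
      _ < ε := hN
end

section
/- A function f : ℕ → ℂ lies in the ℂ-linear span, inside the vector space of all functions ℕ → ℂ, of the set of integer-valued functions (i.e., functions of the form n ↦ g(n) with g : ℕ → ℤ, viewed as complex-valued) if and only if there exists a finitely generated additive subgroup G of ℂ such that f(n) ∈ G for all n ∈ ℕ. -/
/-- A function f : ℕ → ℂ lies in the ℂ-linear span of the
integer-valued functions if and only if all of its values lie in some finitely
generated additive subgroup of ℂ. -/
theorem mem_span_integer_valued_iff_values_in_fg_subgroup (f : ℕ → ℂ) :
    f ∈ Submodule.span ℂ {u : ℕ → ℂ | ∃ g : ℕ → ℤ, u = fun n => (g n : ℂ)} ↔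
      ∃ G : AddSubgroup ℂ, G.FG ∧ ∀ n : ℕ, f n ∈ G := by
  constructor
  · intro hf
    induction hf using Submodule.span_induction with
    | mem u hu =>
      obtain ⟨g, rfl⟩ := hu
      refine ⟨AddSubgroup.closure {1}, ⟨{1}, by simp⟩, fun n => ?_⟩
      exact AddSubgroup.mem_closure_singleton.2 ⟨g n, by simp⟩
    | zero => exact ⟨⊥, ⟨∅, by simp⟩, fun n => zero_mem _⟩
    | add u v _ _ hu hv =>
      obtain ⟨G, hG, huG⟩ := hu
      obtain ⟨H, hH, hvH⟩ := hv
      exact ⟨G ⊔ H, hG.sup hH, fun n => AddSubgroup.add_mem_sup (huG n) (hvH n)⟩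
    | smul c u _ hu =>
      obtain ⟨G, ⟨S, rfl⟩, huG⟩ := hu
      classical
      refine ⟨(AddSubgroup.closure (S : Set ℂ)).map (AddMonoidHom.mulLeft c),
        ⟨S.image (AddMonoidHom.mulLeft c), ?_⟩, fun n => ⟨u n, huG n, rfl⟩⟩
      rw [Finset.coe_image, AddMonoidHom.map_closure]
  · rintro ⟨G, ⟨S, rfl⟩, hf⟩
    have hcoeff (n : ℕ) : ∃ a : ℂ → ℤ, ∑ c ∈ S, a c • c = f n := by
      have hn := hf n
      rw [← Submodule.span_int_eq_addSubgroupClosure, Submodule.mem_toAddSubgroup,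
        Submodule.mem_span_finset] at hn
      obtain ⟨a, -, ha⟩ := hn
      exact ⟨a, ha⟩
    choose a ha using hcoeff
    have hsum : f = ∑ c ∈ S, c • fun n => (a n c : ℂ) := by
      ext n
      simp [← ha n, mul_comm]
    rw [hsum]
    exact Submodule.sum_mem _ fun c _ =>
      Submodule.smul_mem _ c (Submodule.subset_span ⟨fun n => a n c, rfl⟩)
end

section
/- Let T > 0 and let f : ℝ → ℂ be an infinitely differentiable function that is periodic with period T. Then its Fourier coefficients are rapidly decreasing: for every k ∈ ℕ there is a constant C ≥ 0 such that for all n ∈ ℤ, ‖c_n(f)‖ ≤ C / (1 + |n|)^k, where c_n(f) = (1/T) ∫_0^T f(x)·exp(−2πi n x / T) dx. -/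
open scoped Real

lemma norm_fourierCoeffOn_le {a b : ℝ} (hab : a < b) (f : ℝ → ℂ) (n : ℤ) :
    ‖fourierCoeffOn hab f n‖ ≤ (1 / (b - a)) * ∫ x in a..b, ‖f x‖ := by
  have hba : 0 < b - a := sub_pos.2 hab
  rw [fourierCoeffOn_eq_integral, norm_smul, Real.norm_of_nonneg (by positivity)]
  gcongr
  refine (intervalIntegral.norm_integral_le_integral_norm hab.le).trans_eq ?_
  simp only [norm_smul, fourier_apply, Circle.norm_coe, one_mul]

lemma Function.Periodic.fourierCoeffOn_eq_deriv {T : ℝ} (hT : 0 < T) {f : ℝ → ℂ}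
    (hf : ContDiff ℝ 1 f) (hper : Function.Periodic f T) {n : ℤ} (hn : n ≠ 0) :
    fourierCoeffOn hT f n = T / (2 * π * Complex.I * n) * fourierCoeffOn hT (deriv f) n := by
  have h0 : f T = f 0 := by simpa using hper 0
  rw [fourierCoeffOn_of_hasDerivAt hT hn
    (fun x _ => (hf.differentiable one_ne_zero x).hasDerivAt)
    ((hf.continuous_deriv le_rfl).intervalIntegrable _ _), h0]
  push_cast
  have : (n : ℂ) ≠ 0 := by exact_mod_cast hn
  have : (π : ℂ) ≠ 0 := by exact_mod_cast Real.pi_ne_zero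
  have := Complex.I_ne_zero
  field_simp
  ring

lemma Function.Periodic.exists_pow_mul_norm_fourierCoeffOn_le {T : ℝ} (hT : 0 < T) {k : ℕ}
    {f : ℝ → ℂ} (hf : ContDiff ℝ k f) (hper : Function.Periodic f T) :
    ∃ C : ℝ, 0 ≤ C ∧ ∀ n : ℤ, (1 + |(n : ℝ)|) ^ k * ‖fourierCoeffOn hT f n‖ ≤ C := by
  induction k generalizing f with
  | zero =>
    refine ⟨_, (norm_nonneg _).trans (norm_fourierCoeffOn_le hT f 0), fun n => ?_⟩
    simpa using norm_fourierCoeffOn_le hT f n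
  | succ k ih =>
    have hper' : Function.Periodic (deriv f) T := fun x => by
      rw [← deriv_comp_add_const, hper.funext]
    have hf' : ContDiff ℝ k (deriv f) := by
      rw [Nat.cast_succ] at hf
      exact (contDiff_succ_iff_deriv.1 hf).2.2
    obtain ⟨C, hC, h⟩ := ih hf' hper'
    refine ⟨T / π * C + ‖fourierCoeffOn hT f 0‖, by positivity, fun n => ?_⟩
    rcases eq_or_ne n 0 with rfl | hn
    · have : 0 ≤ T / π * C := by positivity
      simpa using this
    have hn1 : (1 : ℝ) ≤ |(n : ℝ)| := by exact_mod_cast Int.one_le_abs hn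
    have hf1 : ContDiff ℝ 1 f := hf.of_le (by exact_mod_cast Nat.le_add_left 1 k)
    refine le_add_of_le_of_nonneg ?_ (norm_nonneg _)
    rw [hper.fourierCoeffOn_eq_deriv hT hf1 hn]
    have hnorm : ‖(T : ℂ) / (2 * π * Complex.I * n)‖ = T / (2 * π * |(n : ℝ)|) := by
      simp [abs_of_pos hT, abs_of_pos Real.pi_pos]
    have hfac : (1 + |(n : ℝ)|) * (T / (2 * π * |(n : ℝ)|)) ≤ T / π := by
      calc (1 + |(n : ℝ)|) * (T / (2 * π * |(n : ℝ)|))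
          ≤ (2 * |(n : ℝ)|) * (T / (2 * π * |(n : ℝ)|)) := by gcongr; linarith
        _ = T / π := by field_simp
    calc (1 + |(n : ℝ)|) ^ (k + 1) *
          ‖(T : ℂ) / (2 * π * Complex.I * n) * fourierCoeffOn hT (deriv f) n‖
        = ((1 + |(n : ℝ)|) * (T / (2 * π * |(n : ℝ)|))) *
          ((1 + |(n : ℝ)|) ^ k * ‖fourierCoeffOn hT (deriv f) n‖) := by
          rw [norm_mul, hnorm]; ring
      _ ≤ T / π * C := by gcongr; exact h n

/-- The Fourier coefficients of a smooth T-periodic function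
f : ℝ → ℂ are rapidly decreasing: for every k there is C ≥ 0 with
‖c_n(f)‖ ≤ C / (1 + |n|)^k for all n ∈ ℤ. -/
theorem fourierCoeff_rapid_decay_of_smooth_periodic
    (T : ℝ) (hT : 0 < T) (f : ℝ → ℂ) (hf : ContDiff ℝ (⊤ : ℕ∞) f)
    (hper : Function.Periodic f T) :
    ∀ k : ℕ, ∃ C : ℝ, 0 ≤ C ∧ ∀ n : ℤ,
      ‖(1 / (T : ℂ)) *
          ∫ x in (0 : ℝ)..T,
            f x * Complex.exp (-(2 * (π : ℂ) * Complex.I * (n : ℂ) * (x : ℂ) / (T : ℂ)))‖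
        ≤ C / (1 + |(n : ℝ)|) ^ k := by
  intro k
  obtain ⟨C, hC, h⟩ := hper.exists_pow_mul_norm_fourierCoeffOn_le hT (k := k)
    (hf.of_le (by exact_mod_cast le_top))
  refine ⟨C, hC, fun n => ?_⟩
  rw [le_div_iff₀' (by positivity)]
  refine Eq.trans_le ?_ (h n)
  congr 2
  rw [fourierCoeffOn_eq_integral, Complex.real_smul]
  push_cast
  rw [sub_zero]
  congr 1
  refine intervalIntegral.integral_congr fun x _ => ?_
  simp only [fourier_coe_apply, smul_eq_mul]
  rw [mul_comm]
  congr 2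
  push_cast
  ring
end

section
/- Let T > 0 and let c : ℤ → ℂ be rapidly decreasing, i.e., for every k ∈ ℕ there is a constant C ≥ 0 with (1 + |n|)^k·‖c(n)‖ ≤ C for all n ∈ ℤ. Then the series f(x) = ∑_{n ∈ ℤ} c(n)·exp(2πi n x / T) converges for every x ∈ ℝ, defines an infinitely differentiable function f : ℝ → ℂ that is periodic with period T, and the Fourier coefficients of f are c: for every n ∈ ℤ, (1/T) ∫_0^T f(x)·exp(−2πi n x / T) dx = c(n). -/
open scoped Real

theorem summable_one_add_abs_pow_mul_norm {E : Type*} [SeminormedAddCommGroup E] {c : ℤ → E}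
    (hc : ∀ k : ℕ, ∃ C : ℝ, 0 ≤ C ∧ ∀ n : ℤ, (1 + |(n : ℝ)|) ^ k * ‖c n‖ ≤ C) (k : ℕ) :
    Summable fun n : ℤ => (1 + |(n : ℝ)|) ^ k * ‖c n‖ := by
  obtain ⟨C, hC, h⟩ := hc (k + 2)
  refine Summable.of_norm_bounded_eventually
    ((Real.summable_one_div_int_pow.mpr one_lt_two).mul_left C) ?_
  filter_upwards [(Set.finite_singleton (0 : ℤ)).compl_mem_cofinite] with n hn
  have hn0 : (n : ℝ) ≠ 0 := Int.cast_ne_zero.mpr hn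
  rw [Real.norm_of_nonneg (by positivity), mul_one_div, le_div_iff₀ (by positivity)]
  refine le_trans ?_ (h n)
  have hsq : (n : ℝ) ^ 2 ≤ (1 + |(n : ℝ)|) ^ 2 := by
    rw [← sq_abs (n : ℝ)]
    gcongr
    linarith
  calc (1 + |(n : ℝ)|) ^ k * ‖c n‖ * (n : ℝ) ^ 2
      ≤ (1 + |(n : ℝ)|) ^ k * ‖c n‖ * (1 + |(n : ℝ)|) ^ 2 := by gcongr
    _ = (1 + |(n : ℝ)|) ^ (k + 2) * ‖c n‖ := by ring

theorem iteratedDeriv_const_mul_cexp_ofReal (a b : ℂ) (k : ℕ) :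
    iteratedDeriv k (fun x : ℝ => a * Complex.exp (b * x)) =
      fun x : ℝ => b ^ k * (a * Complex.exp (b * x)) := by
  induction k with
  | zero => simp
  | succ k ih =>
    rw [iteratedDeriv_succ, ih]
    funext x
    have h : HasDerivAt (fun x : ℝ => b * (x : ℂ)) (b * 1) x :=
      (Complex.ofRealCLM.hasDerivAt (x := x)).const_mul b
    rw [((h.cexp.const_mul a).const_mul (b ^ k)).deriv]
    ring

theorem intervalIntegral_cexp_two_pi_mul_int {T : ℝ} (hT : T ≠ 0) (m : ℤ) :
    ∫ x in (0 : ℝ)..T, Complex.exp (2 * π * Complex.I * m / T * x) =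
      if m = 0 then (T : ℂ) else 0 := by
  have hT' : (T : ℂ) ≠ 0 := Complex.ofReal_ne_zero.mpr hT
  split_ifs with hm
  · simp [hm]
  · have hb : 2 * π * Complex.I * m / T ≠ 0 :=
      div_ne_zero (mul_ne_zero Complex.two_pi_I_ne_zero (Int.cast_ne_zero.mpr hm)) hT'
    have hexp : Complex.exp (2 * π * Complex.I * m / T * T) = 1 := by
      rw [div_mul_cancel₀ _ hT', mul_comm, Complex.exp_int_mul_two_pi_mul_I]
    rw [integral_exp_mul_complex hb, hexp]
    simp

/-- If c : ℤ → ℂ is rapidly decreasing, then the Fourier series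
∑_{n ∈ ℤ} c(n)·exp(2πinx/T) converges at every x ∈ ℝ, its sum f is an
infinitely differentiable T-periodic function, and the Fourier coefficients of
f are exactly the c(n). -/
theorem smooth_periodic_function_of_rapidly_decreasing_coeffs
    (T : ℝ) (hT : 0 < T) (c : ℤ → ℂ)
    (hc : ∀ k : ℕ, ∃ C : ℝ, 0 ≤ C ∧ ∀ n : ℤ, (1 + |(n : ℝ)|) ^ k * ‖c n‖ ≤ C) :
    ∃ f : ℝ → ℂ,
      (∀ x : ℝ, HasSum
        (fun n : ℤ => c n * Complex.exp (2 * (π : ℂ) * Complex.I * (n : ℂ) * (x : ℂ) / (T : ℂ)))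
        (f x)) ∧
      ContDiff ℝ (⊤ : ℕ∞) f ∧
      Function.Periodic f T ∧
      ∀ n : ℤ,
        (1 / (T : ℂ)) *
            ∫ x in (0 : ℝ)..T,
              f x * Complex.exp (-(2 * (π : ℂ) * Complex.I * (n : ℂ) * (x : ℂ) / (T : ℂ)))
          = c n := by
  have hT' : (T : ℂ) ≠ 0 := Complex.ofReal_ne_zero.mpr hT.ne'
  let b : ℤ → ℂ := fun n => 2 * π * Complex.I * n / T
  have hb (n : ℤ) (x : ℝ) : 2 * (π : ℂ) * Complex.I * n * x / T = b n * x := by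
    simp only [b]
    ring
  have hnorm (n : ℤ) (x : ℝ) : ‖Complex.exp (b n * x)‖ = 1 := by
    have : b n * x = ((2 * π * n / T * x : ℝ) : ℂ) * Complex.I := by
      simp only [b]
      push_cast
      ring
    rw [this, Complex.norm_exp_ofReal_mul_I]
  have hbnorm (n : ℤ) : ‖b n‖ ≤ 2 * π / T * (1 + |(n : ℝ)|) := by
    have : ‖b n‖ = 2 * π / T * |(n : ℝ)| := by
      simp [b, abs_of_pos hT, abs_of_pos Real.pi_pos]
      ring
    rw [this]
    gcongr
    linarith
  have hsum : Summable fun n => ‖c n‖ := by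
    simpa using summable_one_add_abs_pow_mul_norm hc 0
  have hs (x : ℝ) : HasSum (fun n : ℤ => c n * Complex.exp (b n * x))
      (∑' n : ℤ, c n * Complex.exp (b n * x)) :=
    (Summable.of_norm_bounded hsum fun n => by simp [hnorm]).hasSum
  refine ⟨fun x => ∑' n : ℤ, c n * Complex.exp (b n * x),
    fun x => ?_, ?_, fun x => ?_, fun n => ?_⟩
  · simpa only [hb] using hs x
  · refine contDiff_tsum (v := fun k (n : ℤ) => (2 * π / T) ^ k * ((1 + |(n : ℝ)|) ^ k * ‖c n‖))
      (fun n => ?_)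
      (fun k _ => (summable_one_add_abs_pow_mul_norm hc k).mul_left _) fun k n x _ => ?_
    · exact contDiff_const.mul (contDiff_const.mul Complex.ofRealCLM.contDiff).cexp
    · rw [norm_iteratedFDeriv_eq_norm_iteratedDeriv, iteratedDeriv_const_mul_cexp_ofReal,
        norm_mul, norm_mul, hnorm, mul_one, norm_pow, ← mul_assoc, ← mul_pow]
      gcongr
      exact hbnorm n
  · refine tsum_congr fun n => ?_
    have hper : b n * ((x + T : ℝ) : ℂ) = b n * x + n * (2 * π * Complex.I) := by
      simp only [b]
      push_cast
      field_simp
    rw [hper, Complex.exp_add, Complex.exp_int_mul_two_pi_mul_I, mul_one]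
  · have hterm (m : ℤ) (x : ℝ) :
        c m * Complex.exp (b m * x) * Complex.exp (-(b n * x)) =
          c m * Complex.exp (2 * π * Complex.I * (m - n : ℤ) / T * x) := by
      rw [mul_assoc, ← Complex.exp_add]
      congr 2
      simp only [b]
      push_cast
      ring
    have hint := intervalIntegral.hasSum_integral_of_dominated_convergence
      (μ := MeasureTheory.volume) (a := 0) (b := T)
      (F := fun m x => c m * Complex.exp (b m * x) * Complex.exp (-(b n * x)))
      (f := fun x => (∑' m : ℤ, c m * Complex.exp (b m * x)) * Complex.exp (-(b n * x)))
      (fun m _ => ‖c m‖)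
      (fun m => (by fun_prop : Continuous _).aestronglyMeasurable)
      (fun m => .of_forall fun x _ => by simp [Complex.exp_neg, hnorm])
      (.of_forall fun _ _ => hsum) intervalIntegrable_const
      (.of_forall fun x _ => (hs x).mul_right _)
    simp only [hterm, intervalIntegral.integral_const_mul,
      intervalIntegral_cexp_two_pi_mul_int hT.ne', sub_eq_zero] at hint
    have hval := hint.unique (hasSum_single n fun m hm => by simp [hm])
    simp only [hb, hval, if_true]
    field_simp
end
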